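/- Let q be a complex number with |q| < 1. Then Σ_{i,j≥0} (−1)^j · q^(i²+2ij+j²+4i+4j) / ((q⁸;q⁸)_i · (q⁸;q⁸)_j) = 1 / ((−q⁸;q⁸)_∞ · (q⁸;q²⁰)_∞ · (q¹²;q²⁰)_∞). (This is the Chen–Yin identity Σ_{i,j≥0} (−1)^j q^(i²/4+ij/2+j²/4+i+j) / ((q²;q²)_i (q²;q²)_j) = 1/((−q²;q²)_∞ (q², q³; q⁵)_∞) after the substitution q ↦ q⁴.) -/

import Mathlib

/-- Finite q-Pochhammer symbol `(a; q)_n = ∏_{k=0}^{n-1} (1 - a q^k)`. -/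
noncomputable def qPoch (a q : ℂ) (n : ℕ) : ℂ := ∏ k ∈ Finset.range n, (1 - a * q ^ k)

/-- Infinite q-Pochhammer symbol `(a; q)_∞ = ∏_{k=0}^{∞} (1 - a q^k)`. -/
noncomputable def qPochInf (a q : ℂ) : ℂ := ∏' k : ℕ, (1 - a * q ^ k)

open Filter Topology Finset

section QPochhammer

theorem qPoch_zero (a q : ℂ) : qPoch a q 0 = 1 := by simp [qPoch]

theorem qPoch_succ (a q : ℂ) (n : ℕ) :
    qPoch a q (n + 1) = qPoch a q n * (1 - a * q ^ n) := by
  simp [qPoch, prod_range_succ]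

theorem qPoch_self_succ (q : ℂ) (n : ℕ) :
    qPoch q q (n + 1) = qPoch q q n * (1 - q ^ (n + 1)) := by
  rw [qPoch_succ, pow_succ']

theorem one_sub_pow_succ_ne_zero {q : ℂ} (hq : ‖q‖ < 1) (n : ℕ) : 1 - q ^ (n + 1) ≠ 0 := by
  intro h
  have h1 : ‖q ^ (n + 1)‖ < 1 := by
    rw [norm_pow]
    exact pow_lt_one₀ (norm_nonneg q) hq n.succ_ne_zero
  rw [← sub_eq_zero.mp h, norm_one] at h1
  exact lt_irrefl _ h1

theorem norm_pow_lt_one {q : ℂ} (hq : ‖q‖ < 1) {n : ℕ} (hn : n ≠ 0) : ‖q ^ n‖ < 1 := by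
  rw [norm_pow]
  exact pow_lt_one₀ (norm_nonneg q) hq hn

theorem qPoch_self_ne_zero {q : ℂ} (hq : ‖q‖ < 1) (n : ℕ) : qPoch q q n ≠ 0 := by
  rw [qPoch, prod_ne_zero_iff]
  intro k _
  rw [← pow_succ']
  exact one_sub_pow_succ_ne_zero hq k

theorem summable_norm_mul_pow (a : ℂ) {q : ℂ} (hq : ‖q‖ < 1) :
    Summable fun k : ℕ => ‖-(a * q ^ k)‖ := by
  simpa [norm_mul, norm_pow] using (summable_geometric_of_lt_one (norm_nonneg q) hq).mul_left ‖a‖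

theorem tendsto_qPoch (a : ℂ) {q : ℂ} (hq : ‖q‖ < 1) :
    Tendsto (qPoch a q) atTop (𝓝 (qPochInf a q)) := by
  have h := (multipliable_one_add_of_summable (summable_norm_mul_pow a hq)).tendsto_prod_tprod_nat
  simpa only [← sub_eq_add_neg] using! h

theorem qPochInf_ne_zero {a q : ℂ} (hq : ‖q‖ < 1) (h : ∀ k, 1 - a * q ^ k ≠ 0) :
    qPochInf a q ≠ 0 := by
  have := tprod_one_add_ne_zero_of_summable (f := fun k : ℕ => -(a * q ^ k))
    (fun k => by simpa only [← sub_eq_add_neg] using h k) (summable_norm_mul_pow a hq)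
  simpa only [← sub_eq_add_neg] using! this

theorem qPochInf_self_ne_zero {q : ℂ} (hq : ‖q‖ < 1) : qPochInf q q ≠ 0 :=
  qPochInf_ne_zero hq fun k => by
    rw [← pow_succ']
    exact one_sub_pow_succ_ne_zero hq k

theorem exists_norm_le_of_tendsto {u : ℕ → ℂ} {x : ℂ} (hu : Tendsto u atTop (𝓝 x)) :
    ∃ M, 0 ≤ M ∧ ∀ n, ‖u n‖ ≤ M := by
  obtain ⟨M, hM⟩ := (Metric.isBounded_range_of_tendsto u hu).exists_norm_le
  exact ⟨M, (norm_nonneg _).trans (hM (u 0) ⟨0, rfl⟩), fun n => hM _ ⟨n, rfl⟩⟩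

theorem exists_norm_qPoch_le {q : ℂ} (hq : ‖q‖ < 1) :
    ∃ M, 0 ≤ M ∧ ∀ n, ‖qPoch q q n‖ ≤ M :=
  exists_norm_le_of_tendsto (tendsto_qPoch q hq)

theorem tendsto_inv_qPoch {q : ℂ} (hq : ‖q‖ < 1) :
    Tendsto (fun n => (qPoch q q n)⁻¹) atTop (𝓝 (qPochInf q q)⁻¹) :=
  (tendsto_qPoch q hq).inv₀ (qPochInf_self_ne_zero hq)

theorem exists_norm_inv_qPoch_le {q : ℂ} (hq : ‖q‖ < 1) :
    ∃ M, 0 ≤ M ∧ ∀ n, ‖(qPoch q q n)⁻¹‖ ≤ M :=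
  exists_norm_le_of_tendsto (tendsto_inv_qPoch hq)

theorem one_sub_mul_inv_qPoch_succ {q : ℂ} (hq : ‖q‖ < 1) (n : ℕ) :
    (1 - q ^ (n + 1)) * (qPoch q q (n + 1))⁻¹ = (qPoch q q n)⁻¹ := by
  rw [qPoch_self_succ, mul_inv]
  field_simp [one_sub_pow_succ_ne_zero hq n]

/-- `(-q; q)_n (q; q)_n = (q²; q²)_n`. -/
theorem qPoch_neg_mul_qPoch (q : ℂ) (n : ℕ) :
    qPoch (-q) q n * qPoch q q n = qPoch (q ^ 2) (q ^ 2) n := by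
  simp only [qPoch, ← prod_mul_distrib]
  exact prod_congr rfl fun k _ => by ring

end QPochhammer

section Summation

theorem choose_succ_two (n : ℕ) : (n + 1).choose 2 = n.choose 2 + n := by
  rw [Nat.choose_succ_succ' n 1, Nat.choose_one_right, add_comm]

/-- Series with Gaussian decay `p ^ (r choose 2)` converge for every geometric growth rate. -/
theorem summable_norm_pow_mul_pow_choose (c : ℂ) {p : ℂ} (hp : ‖p‖ < 1) :
    Summable fun r : ℕ => ‖c ^ r * p ^ r.choose 2‖ := by
  have hlim : Tendsto (fun r : ℕ => ‖c‖ * ‖p‖ ^ r) atTop (𝓝 0) := by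
    simpa using (tendsto_pow_atTop_nhds_zero_of_lt_one (norm_nonneg p) hp).const_mul ‖c‖
  refine summable_of_ratio_norm_eventually_le (r := 1 / 2) (by norm_num) ?_
  filter_upwards [hlim.eventually_le_const (show (0 : ℝ) < 1 / 2 by norm_num)] with r hr
  simp only [norm_norm, norm_mul, norm_pow, choose_succ_two, pow_succ, pow_add]
  calc ‖c‖ ^ r * ‖c‖ * (‖p‖ ^ r.choose 2 * ‖p‖ ^ r)
      = (‖c‖ * ‖p‖ ^ r) * (‖c‖ ^ r * ‖p‖ ^ r.choose 2) := by ring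
    _ ≤ 1 / 2 * (‖c‖ ^ r * ‖p‖ ^ r.choose 2) := by gcongr

theorem summable_norm_pow_choose {p : ℂ} (hp : ‖p‖ < 1) :
    Summable fun r : ℕ => ‖p ^ r.choose 2‖ := by
  simpa only [one_pow, one_mul] using summable_norm_pow_mul_pow_choose 1 hp

theorem summable_bounded_mul {b g : ℕ → ℂ} {M : ℝ} (hb : ∀ r, ‖b r‖ ≤ M)
    (hg : Summable fun r => ‖g r‖) : Summable fun r => b r * g r := by
  refine Summable.of_norm_bounded (hg.mul_left M) fun r => ?_
  rw [norm_mul]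
  exact mul_le_mul_of_nonneg_right (hb r) (norm_nonneg _)

/-- Tannery's theorem for bounded coefficients. -/
theorem tendsto_tsum_bounded_mul {c : ℕ → ℕ → ℂ} {d g : ℕ → ℂ} {M : ℝ}
    (hc : ∀ n k, ‖c n k‖ ≤ M) (hd : ∀ k, Tendsto (c · k) atTop (𝓝 (d k)))
    (hg : Summable fun k => ‖g k‖) :
    Tendsto (fun n => ∑' k, c n k * g k) atTop (𝓝 (∑' k, d k * g k)) := by
  refine tendsto_tsum_of_dominated_convergence (hg.mul_left M)
    (fun k => (hd k).mul_const (g k)) (Eventually.of_forall fun n k => ?_)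
  rw [norm_mul]
  exact mul_le_mul_of_nonneg_right (hc n k) (norm_nonneg _)

/-- Tannery's theorem for finite sums of growing length. -/
theorem tendsto_sum_range_bounded_mul {c : ℕ → ℕ → ℂ} {d g : ℕ → ℂ} {s : ℕ → ℕ} {M : ℝ}
    (hs : Tendsto s atTop atTop) (hc : ∀ n k, ‖c n k‖ ≤ M)
    (hd : ∀ k, Tendsto (c · k) atTop (𝓝 (d k))) (hg : Summable fun k => ‖g k‖) :
    Tendsto (fun n => ∑ k ∈ range (s n), c n k * g k) atTop (𝓝 (∑' k, d k * g k)) := by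
  have hM : 0 ≤ M := (norm_nonneg _).trans (hc 0 0)
  have key : Tendsto (fun n => ∑' k, (if k ∈ range (s n) then c n k else 0) * g k) atTop
      (𝓝 (∑' k, d k * g k)) := by
    refine tendsto_tsum_bounded_mul (M := M) (fun n k => ?_) (fun k => ?_) hg
    · split_ifs
      · exact hc n k
      · rwa [norm_zero]
    · refine (hd k).congr' ?_
      filter_upwards [hs.eventually_gt_atTop k] with n hn
      simp [hn]
  refine key.congr fun n => ?_
  rw [tsum_eq_sum (s := range (s n)) fun k hk => by rw [if_neg hk, zero_mul]]
  exact sum_congr rfl fun k hk => by rw [if_pos hk]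

theorem tsum_prod_eq_tsum_sum_antidiagonal {f : ℕ × ℕ → ℂ} (hf : Summable f) :
    ∑' p, f p = ∑' n, ∑ p ∈ antidiagonal n, f p := by
  have hf' := Finset.HasAntidiagonal.sigmaAntidiagonalEquivProd.summable_iff.mpr hf
  rw [← Finset.HasAntidiagonal.sigmaAntidiagonalEquivProd.tsum_eq f]
  refine (hf'.tsum_sigma' fun n => (hasSum_fintype _).summable).trans (tsum_congr fun n => ?_)
  rw [tsum_fintype]
  exact Finset.sum_coe_sort (antidiagonal n) f

theorem tsum_sub_succ_eq_zero {g : ℕ → ℂ} (hg : Summable g) (h0 : g 0 = 0) :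
    ∑' r, (g r - g (r + 1)) = 0 := by
  rw [hg.tsum_sub ((summable_nat_add_iff 1).mpr hg), hg.tsum_eq_zero_add, h0]
  ring

/-- A null sequence with `d m = d (m + 1) + q ^ (m + k) * d (m + 2)` vanishes. -/
theorem eq_zero_of_recurrence {q : ℂ} (hq : ‖q‖ < 1) (k : ℕ) {d : ℕ → ℂ}
    (hd : ∀ m, d m = d (m + 1) + q ^ (m + k) * d (m + 2)) (h0 : Tendsto d atTop (𝓝 0)) (m : ℕ) :
    d m = 0 := by
  set s : ℕ → ℝ := fun n => ∑ i ∈ range n, ‖q‖ ^ i with hs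
  set W : ℝ := ∑' i : ℕ, ‖q‖ ^ i with hW
  have hsW (n : ℕ) : s n ≤ W :=
    (summable_geometric_of_lt_one (norm_nonneg q) hq).sum_le_tsum _ fun i _ => by positivity
  have hstep (n : ℕ) : s (n + 1) = s n + ‖q‖ ^ n := sum_range_succ _ _
  have bound (ε : ℝ) (hε : 0 < ε) : ‖d m‖ ≤ ε * Real.exp (W - s m) := by
    obtain ⟨N, hN⟩ := eventually_atTop.mp
      ((tendsto_zero_iff_norm_tendsto_zero.mp h0).eventually_le_const hε)
    have main : ∀ j, ∀ i ≥ j, ‖d i‖ ≤ ε * Real.exp (W - s j) := by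
      have base : ∀ j ≥ N, ∀ i ≥ j, ‖d i‖ ≤ ε * Real.exp (W - s j) := fun j hj i hi =>
        (hN i (hj.trans hi)).trans
          (le_mul_of_one_le_right hε.le (Real.one_le_exp (sub_nonneg.mpr (hsW j))))
      intro j
      rcases le_total N j with hj | hj
      · exact base j hj
      induction hj using Nat.decreasingInduction with
      | self => exact base N le_rfl
      | of_succ j hj ih =>
        intro i hi
        rcases hi.eq_or_lt with rfl | hi
        · have hpow : ‖q ^ (j + k)‖ ≤ ‖q‖ ^ j := by
            rw [norm_pow]
            exact pow_le_pow_of_le_one (norm_nonneg q) hq.le (Nat.le_add_right j k)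
          calc ‖d j‖ ≤ ‖d (j + 1)‖ + ‖q ^ (j + k)‖ * ‖d (j + 2)‖ := by
                rw [hd j, ← norm_mul]
                exact norm_add_le _ _
            _ ≤ ε * Real.exp (W - s (j + 1)) + ‖q‖ ^ j * (ε * Real.exp (W - s (j + 1))) := by
                gcongr
                · exact ih _ le_rfl
                · exact ih _ (Nat.le_succ _)
            _ = ε * ((‖q‖ ^ j + 1) * Real.exp (W - s (j + 1))) := by ring
            _ ≤ ε * (Real.exp (‖q‖ ^ j) * Real.exp (W - s (j + 1))) := by
                gcongr
                exact Real.add_one_le_exp _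
            _ = ε * Real.exp (W - s j) := by
                rw [← Real.exp_add, hstep]
                ring_nf
        · refine (ih i hi).trans ?_
          gcongr
          rw [hstep]
          exact le_add_of_nonneg_right (by positivity)
    exact main m m le_rfl
  have hlim : Tendsto (fun ε : ℝ => ε * Real.exp (W - s m)) (𝓝[>] 0) (𝓝 0) := by
    have : Tendsto (fun ε : ℝ => ε * Real.exp (W - s m)) (𝓝 0) (𝓝 (0 * Real.exp (W - s m))) :=
      tendsto_id.mul_const _
    rw [zero_mul] at this
    exact this.mono_left nhdsWithin_le_nhds
  exact norm_le_zero_iff.mp (ge_of_tendsto hlim (eventually_mem_nhdsWithin.mono bound))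

end Summation
section RogersSzego

variable {q : ℂ}

/-- Three-term recurrence of the Rogers–Szegő polynomials, divided by `(q; q)_n`. -/
theorem rogersSzego_recurrence (hq : ‖q‖ < 1) (t : ℂ) (n : ℕ) :
    (1 - q ^ (n + 2)) *
        ∑ p ∈ antidiagonal (n + 2), t ^ p.2 * ((qPoch q q p.1)⁻¹ * (qPoch q q p.2)⁻¹) =
      (1 + t) * ∑ p ∈ antidiagonal (n + 1), t ^ p.2 * ((qPoch q q p.1)⁻¹ * (qPoch q q p.2)⁻¹) -
        t * ∑ p ∈ antidiagonal n, t ^ p.2 * ((qPoch q q p.1)⁻¹ * (qPoch q q p.2)⁻¹) := by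
  set f : ℕ × ℕ → ℂ := fun p => t ^ p.2 * ((qPoch q q p.1)⁻¹ * (qPoch q q p.2)⁻¹) with hf
  have hl (i j : ℕ) : (1 - q ^ (i + 1)) * f (i + 1, j) = f (i, j) := by
    simp only [hf]
    rw [← one_sub_mul_inv_qPoch_succ hq i]
    ring
  have hr (i j : ℕ) : (1 - q ^ (j + 1)) * f (i, j + 1) = t * f (i, j) := by
    simp only [hf]
    rw [← one_sub_mul_inv_qPoch_succ hq j]
    ring
  have hsplit : (1 - q ^ (n + 2)) * ∑ p ∈ antidiagonal (n + 2), f p =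
      ∑ p ∈ antidiagonal (n + 2), (1 - q ^ p.1) * f p +
      ∑ p ∈ antidiagonal (n + 2), (1 - q ^ p.2) * f p -
      ∑ p ∈ antidiagonal (n + 2), (1 - q ^ p.1) * (1 - q ^ p.2) * f p := by
    rw [mul_sum, ← sum_add_distrib, ← sum_sub_distrib]
    refine sum_congr rfl fun p hp => ?_
    rw [← mem_antidiagonal.mp hp]
    ring
  have h1 : ∑ p ∈ antidiagonal (n + 2), (1 - q ^ p.1) * f p = ∑ p ∈ antidiagonal (n + 1), f p := by
    rw [Nat.sum_antidiagonal_succ]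
    simp [hl]
  have h2 : ∑ p ∈ antidiagonal (n + 2), (1 - q ^ p.2) * f p =
      t * ∑ p ∈ antidiagonal (n + 1), f p := by
    rw [Nat.sum_antidiagonal_succ']
    simp [hr, mul_sum]
  have h3 : ∑ p ∈ antidiagonal (n + 2), (1 - q ^ p.1) * (1 - q ^ p.2) * f p =
      t * ∑ p ∈ antidiagonal n, f p := by
    rw [Nat.sum_antidiagonal_succ, Nat.sum_antidiagonal_succ', mul_sum]
    simp only [pow_zero, sub_self, zero_mul, mul_zero, zero_add]
    refine sum_congr rfl fun p _ => ?_
    rw [← hr, ← hl p.1 (p.2 + 1)]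
    ring
  rw [hsplit, h1, h2, h3]
  ring

theorem rogersSzego_zero (t : ℂ) :
    ∑ p ∈ antidiagonal 0, t ^ p.2 * ((qPoch q q p.1)⁻¹ * (qPoch q q p.2)⁻¹) = 1 := by
  simp [qPoch_zero]

theorem rogersSzego_one (t : ℂ) :
    ∑ p ∈ antidiagonal 1, t ^ p.2 * ((qPoch q q p.1)⁻¹ * (qPoch q q p.2)⁻¹) =
      (1 + t) * (1 - q)⁻¹ := by
  rw [Nat.sum_antidiagonal_succ]
  simp [qPoch]
  ring

/-- Gauss's evaluation of the alternating sum of `q`-binomial coefficients. -/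
theorem rogersSzego_neg_one (hq : ‖q‖ < 1) (m : ℕ) :
    ∑ p ∈ antidiagonal (2 * m), (-1) ^ p.2 * ((qPoch q q p.1)⁻¹ * (qPoch q q p.2)⁻¹) =
        (qPoch (q ^ 2) (q ^ 2) m)⁻¹ ∧
      ∑ p ∈ antidiagonal (2 * m + 1), (-1) ^ p.2 * ((qPoch q q p.1)⁻¹ * (qPoch q q p.2)⁻¹) =
        0 := by
  induction m with
  | zero =>
    constructor
    · rw [mul_zero, rogersSzego_zero, qPoch_zero, inv_one]
    · rw [mul_zero, zero_add, rogersSzego_one]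
      ring
  | succ m ih =>
    have h1 := rogersSzego_recurrence hq (-1) (2 * m)
    have h2 := rogersSzego_recurrence hq (-1) (2 * m + 1)
    rw [ih.1] at h1
    rw [ih.2] at h2
    constructor
    · rw [qPoch_self_succ, mul_inv, ← pow_mul]
      have := one_sub_pow_succ_ne_zero hq (2 * m + 1)
      rw [eq_mul_inv_iff_mul_eq₀ (by exact this)]
      linear_combination h1
    · have := one_sub_pow_succ_ne_zero hq (2 * m + 2)
      refine (mul_eq_zero.mp ?_).resolve_left this
      linear_combination h2

/-- The Rogers–Szegő polynomials in base `q²` factor at `t = q`. -/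
theorem rogersSzego_sq (hq : ‖q‖ < 1) (n : ℕ) :
    ∑ p ∈ antidiagonal n,
      q ^ p.2 * ((qPoch (q ^ 2) (q ^ 2) p.1)⁻¹ * (qPoch (q ^ 2) (q ^ 2) p.2)⁻¹) =
      (qPoch q q n)⁻¹ := by
  have hq2 : ‖q ^ 2‖ < 1 := norm_pow_lt_one hq two_ne_zero
  induction n using Nat.twoStepInduction with
  | zero => rw [rogersSzego_zero, qPoch_zero, inv_one]
  | one =>
    have h1 := one_sub_pow_succ_ne_zero hq 0
    have h2 := one_sub_pow_succ_ne_zero hq 1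
    simp only [zero_add, pow_one, Nat.reduceAdd] at h1 h2
    rw [rogersSzego_one]
    simp only [qPoch, prod_range_one, pow_zero, mul_one]
    field_simp
    ring
  | more n ih0 ih1 =>
    have h := rogersSzego_recurrence hq2 q n
    rw [ih0, ih1] at h
    have h2 := one_sub_pow_succ_ne_zero hq2 (n + 1)
    have e0 := one_sub_mul_inv_qPoch_succ hq n
    have e1 := one_sub_mul_inv_qPoch_succ hq (n + 1)
    refine mul_left_cancel₀ (by exact h2) (h.trans ?_)
    rw [← e0, ← e1]
    ring

end RogersSzego

section QBinomial

variable {p : ℂ}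

/-- The homogeneous `q`-binomial theorem. -/
theorem prod_add_mul_pow_eq_sum (hp : ‖p‖ < 1) (x y : ℂ) (n : ℕ) :
    ∏ k ∈ range n, (x + y * p ^ k) =
      qPoch p p n * ∑ k ∈ antidiagonal n,
        (qPoch p p k.1)⁻¹ * (qPoch p p k.2)⁻¹ * (y ^ k.1 * p ^ k.1.choose 2 * x ^ k.2) := by
  induction n with
  | zero => simp [qPoch_zero]
  | succ n ih =>
    set f : ℕ × ℕ → ℂ := fun k =>
      (qPoch p p k.1)⁻¹ * (qPoch p p k.2)⁻¹ * (y ^ k.1 * p ^ k.1.choose 2 * x ^ k.2) with hf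
    have hl (i j : ℕ) : (1 - p ^ (i + 1)) * p ^ j * f (i + 1, j) = y * p ^ (i + j) * f (i, j) := by
      simp only [hf]
      rw [← one_sub_mul_inv_qPoch_succ hp i, choose_succ_two]
      ring
    have hr (i j : ℕ) : (1 - p ^ (j + 1)) * f (i, j + 1) = x * f (i, j) := by
      simp only [hf]
      rw [← one_sub_mul_inv_qPoch_succ hp j]
      ring
    have h1 : ∑ k ∈ antidiagonal (n + 1), (1 - p ^ k.1) * p ^ k.2 * f k =
        y * p ^ n * ∑ k ∈ antidiagonal n, f k := by
      rw [Nat.sum_antidiagonal_succ, mul_sum]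
      simp only [pow_zero, sub_self, zero_mul, zero_add]
      refine sum_congr rfl fun k hk => ?_
      rw [hl, mem_antidiagonal.mp hk]
    have h2 : ∑ k ∈ antidiagonal (n + 1), (1 - p ^ k.2) * f k =
        x * ∑ k ∈ antidiagonal n, f k := by
      rw [Nat.sum_antidiagonal_succ', mul_sum]
      simp [hr]
    have hsplit : (1 - p ^ (n + 1)) * ∑ k ∈ antidiagonal (n + 1), f k =
        ∑ k ∈ antidiagonal (n + 1), (1 - p ^ k.1) * p ^ k.2 * f k +
        ∑ k ∈ antidiagonal (n + 1), (1 - p ^ k.2) * f k := by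
      rw [mul_sum, ← sum_add_distrib]
      refine sum_congr rfl fun k hk => ?_
      rw [← mem_antidiagonal.mp hk]
      ring
    rw [prod_range_succ, ih, qPoch_self_succ]
    linear_combination (-qPoch p p n) * (hsplit.trans (congrArg₂ (· + ·) h1 h2))

/-- Euler's expansion of `(-y; p)_∞`. -/
theorem qPochInf_neg_eq_tsum (hp : ‖p‖ < 1) (y : ℂ) :
    qPochInf (-y) p = ∑' k, (qPoch p p k)⁻¹ * (y ^ k * p ^ k.choose 2) := by
  obtain ⟨A, hA0, hA⟩ := exists_norm_qPoch_le hp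
  obtain ⟨B, hB0, hB⟩ := exists_norm_inv_qPoch_le hp
  have hlim : Tendsto (fun n => ∑ k ∈ range (n + 1),
      (qPoch p p n * ((qPoch p p k)⁻¹ * (qPoch p p (n - k))⁻¹)) * (y ^ k * p ^ k.choose 2)) atTop
      (𝓝 (∑' k, (qPoch p p k)⁻¹ * (y ^ k * p ^ k.choose 2))) := by
    refine tendsto_sum_range_bounded_mul (M := A * (B * B)) (tendsto_add_atTop_nat 1) ?_ ?_
      (summable_norm_pow_mul_pow_choose y hp)
    · intro n k
      rw [norm_mul, norm_mul]
      gcongr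
      exacts [hA n, hB k, hB _]
    · intro k
      have h := (tendsto_qPoch p hp).mul ((tendsto_const_nhds (x := (qPoch p p k)⁻¹)).mul
        ((tendsto_inv_qPoch hp).comp (tendsto_sub_atTop_nat k)))
      have h0 := qPochInf_self_ne_zero hp
      rwa [mul_left_comm, mul_inv_cancel₀ h0, mul_one] at h
  refine tendsto_nhds_unique (tendsto_qPoch (-y) hp) (hlim.congr fun n => ?_)
  have h := prod_add_mul_pow_eq_sum hp 1 y n
  rw [Nat.sum_antidiagonal_eq_sum_range_succ_mk, mul_sum] at h
  simp only [qPoch, neg_mul, sub_neg_eq_add] at h ⊢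
  rw [h]
  refine sum_congr rfl fun k _ => ?_
  rw [one_pow]
  ring

end QBinomial
section JacobiTripleProduct

variable {p z w : ℂ}

theorem add_choose_two (m n : ℕ) : (m + n).choose 2 = m.choose 2 + n.choose 2 + m * n := by
  induction n with
  | zero => simp
  | succ n ih => rw [← add_assoc, choose_succ_two, choose_succ_two, ih]; ring

theorem two_mul_choose_two_add (n : ℕ) : 2 * n.choose 2 + n = n * n := by
  induction n with
  | zero => simp
  | succ n ih => rw [choose_succ_two]; linarith

theorem prod_range_pow_eq (p : ℂ) (n : ℕ) : ∏ k ∈ range n, p ^ k = p ^ n.choose 2 := by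
  induction n with
  | zero => simp
  | succ n ih => rw [prod_range_succ, ih, choose_succ_two, pow_add]

/-- Finite form of the Jacobi triple product. -/
theorem qPoch_mul_qPoch_eq_sum (hp : ‖p‖ < 1) (hp0 : p ≠ 0) (hzw : z * w = p) (N : ℕ) :
    qPoch z p N * qPoch w p N =
      ∑ r ∈ range (N + 1), (qPoch p p (N + N) * ((qPoch p p (N + r))⁻¹ * (qPoch p p (N - r))⁻¹)) *
        ((-z) ^ r * p ^ r.choose 2) +
      ∑ r ∈ range N,
        (qPoch p p (N + N) * ((qPoch p p (N - (r + 1)))⁻¹ * (qPoch p p (N + (r + 1)))⁻¹)) *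
          ((-w) ^ (r + 1) * p ^ (r + 1).choose 2) := by
  have hz0 : z ≠ 0 := left_ne_zero_of_mul (hzw ▸ hp0)
  have hwp : (-z) * (-w) = p := by rw [neg_mul_neg, hzw]
  set K : ℂ := p ^ N.choose 2 * (-z) ^ N * p ^ (N * N) with hK
  have hK0 : K ≠ 0 :=
    mul_ne_zero (mul_ne_zero (pow_ne_zero _ hp0) (pow_ne_zero _ (neg_ne_zero.mpr hz0)))
      (pow_ne_zero _ hp0)
  have hpow (a : ℂ) : a ^ N = ∏ _k ∈ range N, a := by rw [prod_const, card_range]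
  have hleft : ∏ k ∈ range (N + N), (p ^ N + -z * p ^ k) =
      K * (qPoch z p N * qPoch w p N) := by
    have h1 : ∏ k ∈ range N, (p ^ N + -z * p ^ k) =
        p ^ N.choose 2 * (-z) ^ N * qPoch w p N := by
      rw [← prod_range_pow_eq, ← prod_range_reflect, ← prod_range_reflect (fun k => p ^ k),
        hpow (-z), qPoch, ← prod_mul_distrib, ← prod_mul_distrib]
      refine prod_congr rfl fun k hk => ?_
      have hN : N = (N - 1 - k) + (k + 1) := by have := mem_range.mp hk; omega
      nth_rewrite 1 [hN]
      rw [pow_add, pow_succ]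
      linear_combination (-p ^ (N - 1 - k) * p ^ k) * hzw
    have h2 : ∏ k ∈ range N, (p ^ N + -z * p ^ (N + k)) = p ^ (N * N) * qPoch z p N := by
      rw [pow_mul, hpow (p ^ N), qPoch, ← prod_mul_distrib]
      exact prod_congr rfl fun k _ => by ring
    rw [prod_range_add, h1, h2, hK]
    ring
  refine mul_left_cancel₀ hK0 ?_
  rw [← hleft, prod_add_mul_pow_eq_sum hp, Nat.sum_antidiagonal_eq_sum_range_succ_mk,
    Nat.succ_eq_add_one, add_assoc, sum_range_add, ← sum_range_reflect _ N, mul_add,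
    mul_add, mul_sum, mul_sum, mul_sum, mul_sum]
  refine (add_comm _ _).trans (congrArg₂ (· + ·) ?_ ?_)
  · refine sum_congr rfl fun r hr => ?_
    have hrN : r ≤ N := Nat.lt_succ_iff.mp (mem_range.mp hr)
    have hexp : p ^ (N + r).choose 2 * (p ^ N) ^ (N - r) =
        p ^ N.choose 2 * p ^ (N * N) * p ^ r.choose 2 := by
      rw [← pow_mul, ← pow_add, ← pow_add, ← pow_add]
      congr 1
      obtain ⟨t, rfl⟩ := Nat.exists_eq_add_of_le hrN
      rw [add_choose_two, Nat.add_sub_cancel_left]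
      ring
    have hsub : N + N - (N + r) = N - r := by omega
    simp only [hsub]
    rw [mul_assoc ((-z) ^ (N + r)), hexp, hK]
    ring
  · refine sum_congr rfl fun r hr => ?_
    obtain ⟨s, hs⟩ : ∃ s, N = s + (r + 1) := ⟨N - (r + 1), by have := mem_range.mp hr; omega⟩
    have h1 : N - 1 - r = s := by omega
    have h2 : N + N - s = N + (r + 1) := by omega
    have h3 : N - (r + 1) = s := by omega
    have hexp : p ^ s.choose 2 * (p ^ N) ^ (N + (r + 1)) =
        p ^ N.choose 2 * p ^ (N * N) * p ^ (r + 1).choose 2 * p ^ (r + 1) := by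
      rw [← pow_mul, ← pow_add, ← pow_add, ← pow_add, ← pow_add]
      congr 1
      have := two_mul_choose_two_add (r + 1)
      have h4 : N * (N + (r + 1)) = N * N + s * (r + 1) + (r + 1) * (r + 1) := by
        nth_rewrite 1 [hs]; rw [hs]; ring
      have h5 : N.choose 2 = s.choose 2 + (r + 1).choose 2 + s * (r + 1) := by
        rw [hs, add_choose_two]
      linarith
    simp only [h1, h2, h3]
    have hpow : (-z) ^ s * p ^ (r + 1) = (-z) ^ N * (-w) ^ (r + 1) := by
      rw [hs, ← hwp, mul_pow, pow_add (-z) s (r + 1), mul_assoc]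
    rw [mul_assoc ((-z) ^ s), hexp, hK]
    linear_combination (qPoch p p (N + N) * (qPoch p p s)⁻¹ * (qPoch p p (N + (r + 1)))⁻¹ *
      p ^ N.choose 2 * p ^ (N * N) * p ^ (r + 1).choose 2) * hpow

/-- The Jacobi triple product identity, with the bilateral series folded at `0`. -/
theorem jacobi_triple_product (hp : ‖p‖ < 1) (hp0 : p ≠ 0) (hzw : z * w = p) :
    qPochInf p p * (qPochInf z p * qPochInf w p) =
      ∑' r, (-z) ^ r * p ^ r.choose 2 + ∑' r, (-w) ^ (r + 1) * p ^ (r + 1).choose 2 := by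
  obtain ⟨A, hA0, hA⟩ := exists_norm_qPoch_le hp
  obtain ⟨B, hB0, hB⟩ := exists_norm_inv_qPoch_le hp
  have h0 := qPochInf_self_ne_zero hp
  have hNN : Tendsto (fun N : ℕ => N + N) atTop atTop := tendsto_id.atTop_add_atTop tendsto_id
  have hbound (N a b : ℕ) :
      ‖qPoch p p N * ((qPoch p p a)⁻¹ * (qPoch p p b)⁻¹)‖ ≤ A * (B * B) := by
    rw [norm_mul, norm_mul]
    gcongr
    exacts [hA N, hB a, hB b]
  have hlim {a b : ℕ → ℕ} (ha : Tendsto a atTop atTop) (hb : Tendsto b atTop atTop) :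
      Tendsto (fun N => qPoch p p (N + N) * ((qPoch p p (a N))⁻¹ * (qPoch p p (b N))⁻¹)) atTop
        (𝓝 (qPochInf p p)⁻¹) := by
    have h := ((tendsto_qPoch p hp).comp hNN).mul
      (((tendsto_inv_qPoch hp).comp ha).mul ((tendsto_inv_qPoch hp).comp hb))
    rwa [← mul_assoc, mul_inv_cancel₀ h0, one_mul] at h
  have hadd (k : ℕ) : Tendsto (fun N : ℕ => N + k) atTop atTop := tendsto_add_atTop_nat k
  have hsub (k : ℕ) : Tendsto (fun N : ℕ => N - k) atTop atTop := tendsto_sub_atTop_nat k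
  have h1 := tendsto_sum_range_bounded_mul (tendsto_add_atTop_nat 1)
    (fun N r => hbound (N + N) (N + r) (N - r)) (fun r => hlim (hadd r) (hsub r))
    (summable_norm_pow_mul_pow_choose (-z) hp)
  have h2 := tendsto_sum_range_bounded_mul tendsto_id
    (fun N r => hbound (N + N) (N - (r + 1)) (N + (r + 1)))
    (fun r => hlim (hsub (r + 1)) (hadd (r + 1)))
    ((summable_nat_add_iff 1).mpr (summable_norm_pow_mul_pow_choose (-w) hp))
  have h3 := tendsto_nhds_unique ((tendsto_qPoch z hp).mul (tendsto_qPoch w hp))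
    ((h1.add h2).congr fun N => (qPoch_mul_qPoch_eq_sum hp hp0 hzw N).symm)
  rw [h3, tsum_mul_left, tsum_mul_left, ← mul_add, mul_inv_cancel_left₀ h0]

end JacobiTripleProduct
section RogersRamanujan

variable {q : ℂ}

/-- The series `∑ q ^ (s ^ 2 + (m + 1) s) / (q; q)_s`. -/
noncomputable def rrSum (q : ℂ) (m : ℕ) : ℂ :=
  ∑' s, (qPoch q q s)⁻¹ * (q ^ (m + 2)) ^ s * (q ^ 2) ^ s.choose 2

theorem summable_rrSum (hq : ‖q‖ < 1) (c : ℂ) :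
    Summable fun s : ℕ => (qPoch q q s)⁻¹ * c ^ s * (q ^ 2) ^ s.choose 2 := by
  obtain ⟨B, _, hB⟩ := exists_norm_inv_qPoch_le hq
  refine (summable_bounded_mul hB (summable_norm_pow_mul_pow_choose c
    (norm_pow_lt_one hq two_ne_zero))).congr fun s => by ring

theorem rrSum_recurrence (hq : ‖q‖ < 1) (m : ℕ) :
    rrSum q m = rrSum q (m + 1) + q ^ (m + 2) * rrSum q (m + 2) := by
  have hs := fun m : ℕ => summable_rrSum hq (q ^ (m + 2))
  rw [← sub_eq_iff_eq_add', rrSum, rrSum, rrSum, ← (hs m).tsum_sub (hs (m + 1)),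
    ((hs m).sub (hs (m + 1))).tsum_eq_zero_add, ← tsum_mul_left]
  simp only [pow_zero, sub_self, zero_add]
  refine tsum_congr fun s => ?_
  rw [← one_sub_mul_inv_qPoch_succ hq s, choose_succ_two]
  ring

theorem tendsto_rrSum (hq : ‖q‖ < 1) : Tendsto (rrSum q) atTop (𝓝 1) := by
  obtain ⟨B, hB0, hB⟩ := exists_norm_inv_qPoch_le hq
  have hlim (s : ℕ) : Tendsto (fun m : ℕ => (qPoch q q s)⁻¹ * (q ^ (m + 2)) ^ s) atTop
      (𝓝 ((qPoch q q s)⁻¹ * 0 ^ s)) :=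
    ((((tendsto_pow_atTop_nhds_zero_of_norm_lt_one hq).comp
      (tendsto_add_atTop_nat 2)).pow s).const_mul _)
  have hbound (m s : ℕ) : ‖(qPoch q q s)⁻¹ * (q ^ (m + 2)) ^ s‖ ≤ B := by
    rw [norm_mul, norm_pow, norm_pow]
    exact (mul_le_mul (hB s) (pow_le_one₀ (by positivity) (pow_le_one₀ (norm_nonneg q) hq.le))
      (by positivity) hB0).trans_eq (mul_one B)
  have h := tendsto_tsum_bounded_mul hbound hlim
    (summable_norm_pow_choose (norm_pow_lt_one hq two_ne_zero))
  rw [tsum_eq_single 0 (fun s hs => by rw [zero_pow hs, mul_zero, zero_mul])] at h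
  simpa [qPoch_zero] using! h

/-- The common factor of the terms in the two auxiliary well-poised series. -/
noncomputable def wellPoisedTerm (q : ℂ) (m r : ℕ) : ℂ :=
  (-1) ^ r * (q ^ (m + 1)) ^ (2 * r) * (q ^ 5) ^ r.choose 2 *
    (qPoch q q (m + r) * (qPoch q q r)⁻¹)

theorem wellPoisedTerm_succ_right (hq : ‖q‖ < 1) (m r : ℕ) :
    wellPoisedTerm q m (r + 1) * (1 - q ^ (r + 1)) =
      -(wellPoisedTerm q m r * q ^ (2 * (m + 1)) * q ^ (5 * r) * (1 - q ^ (m + r + 1))) := by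
  simp only [wellPoisedTerm]
  rw [← one_sub_mul_inv_qPoch_succ hq r, choose_succ_two, ← add_assoc, qPoch_self_succ]
  ring

theorem wellPoisedTerm_succ_left (m r : ℕ) :
    wellPoisedTerm q (m + 1) r =
      wellPoisedTerm q m r * q ^ (2 * r) * (1 - q ^ (m + r + 1)) := by
  simp only [wellPoisedTerm]
  rw [add_right_comm m 1 r, qPoch_self_succ]
  ring

theorem exists_norm_wellPoisedTerm_ratio_le (hq : ‖q‖ < 1) :
    ∃ M, 0 ≤ M ∧ ∀ m r, ‖(-1) ^ r * (q ^ (m + 1)) ^ (2 * r) *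
      (qPoch q q (m + r) * (qPoch q q r)⁻¹)‖ ≤ M := by
  obtain ⟨A, hA0, hA⟩ := exists_norm_qPoch_le hq
  obtain ⟨B, hB0, hB⟩ := exists_norm_inv_qPoch_le hq
  refine ⟨A * B, by positivity, fun m r => ?_⟩
  have h1 : ‖(-1 : ℂ) ^ r * (q ^ (m + 1)) ^ (2 * r)‖ ≤ 1 := by
    rw [norm_mul, norm_pow, norm_neg, norm_one, one_pow, one_mul, norm_pow, norm_pow]
    exact pow_le_one₀ (by positivity) (pow_le_one₀ (norm_nonneg q) hq.le)
  rw [norm_mul, norm_mul (qPoch q q (m + r))]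
  exact (mul_le_mul h1 (mul_le_mul (hA _) (hB _) (norm_nonneg _) hA0) (by positivity)
    zero_le_one).trans_eq (one_mul _)

theorem summable_wellPoisedTerm_mul_pow (hq : ‖q‖ < 1) (m j : ℕ) :
    Summable fun r => wellPoisedTerm q m r * q ^ (j * r) := by
  obtain ⟨M, _, hM⟩ := exists_norm_wellPoisedTerm_ratio_le hq
  refine (summable_bounded_mul (hM m) (summable_norm_pow_mul_pow_choose (q ^ j)
    (norm_pow_lt_one hq (n := 5) (by norm_num)))).congr fun r => ?_
  rw [wellPoisedTerm, pow_mul]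
  ring

/-- The series `H₁(a) (q; q)_m` at `a = q ^ (m + 1)`. -/
noncomputable def wellPoisedSum₁ (q : ℂ) (m : ℕ) : ℂ :=
  ∑' r, wellPoisedTerm q m r * (q ^ (2 * r) * (1 - q ^ (m + 1 + 2 * r)))

/-- The series `H₂(a) (q; q)_m` at `a = q ^ (m + 1)`. -/
noncomputable def wellPoisedSum₂ (q : ℂ) (m : ℕ) : ℂ :=
  ∑' r, wellPoisedTerm q m r * (q ^ r * (1 - q ^ (2 * (m + 1) + 4 * r)))

theorem summable_wellPoisedSum₁ (hq : ‖q‖ < 1) (m : ℕ) :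
    Summable fun r => wellPoisedTerm q m r * (q ^ (2 * r) * (1 - q ^ (m + 1 + 2 * r))) :=
  ((summable_wellPoisedTerm_mul_pow hq m 2).sub
    ((summable_wellPoisedTerm_mul_pow hq m 4).mul_left (q ^ (m + 1)))).congr fun r => by ring

theorem summable_wellPoisedSum₂ (hq : ‖q‖ < 1) (m : ℕ) :
    Summable fun r => wellPoisedTerm q m r * (q ^ r * (1 - q ^ (2 * (m + 1) + 4 * r))) :=
  ((summable_wellPoisedTerm_mul_pow hq m 1).sub
    ((summable_wellPoisedTerm_mul_pow hq m 5).mul_left (q ^ (2 * (m + 1))))).congr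
      fun r => by ring

theorem wellPoisedSum₁_eq (hq : ‖q‖ < 1) (m : ℕ) :
    wellPoisedSum₁ q m = wellPoisedSum₂ q (m + 1) := by
  have hg : Summable fun r => wellPoisedTerm q m r * q ^ (2 * r) * (1 - q ^ r) :=
    ((summable_wellPoisedTerm_mul_pow hq m 2).sub
      (summable_wellPoisedTerm_mul_pow hq m 3)).congr fun r => by ring
  rw [← sub_eq_zero, wellPoisedSum₁, wellPoisedSum₂,
    ← (summable_wellPoisedSum₁ hq m).tsum_sub (summable_wellPoisedSum₂ hq (m + 1)),
    ← tsum_sub_succ_eq_zero hg (by simp)]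
  refine tsum_congr fun r => ?_
  have h := wellPoisedTerm_succ_right hq m r
  rw [wellPoisedTerm_succ_left]
  linear_combination q ^ (2 * (r + 1)) * h

theorem wellPoisedSum₂_eq (hq : ‖q‖ < 1) (m : ℕ) :
    wellPoisedSum₂ q m = wellPoisedSum₁ q m + q ^ (m + 1) * wellPoisedSum₁ q (m + 1) := by
  have hg : Summable fun r => wellPoisedTerm q m r * q ^ r * (1 - q ^ r) :=
    ((summable_wellPoisedTerm_mul_pow hq m 1).sub
      (summable_wellPoisedTerm_mul_pow hq m 2)).congr fun r => by ring
  rw [← sub_eq_zero, ← sub_sub, wellPoisedSum₁, wellPoisedSum₂, wellPoisedSum₁, ← tsum_mul_left,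
    ← (summable_wellPoisedSum₂ hq m).tsum_sub (summable_wellPoisedSum₁ hq m),
    ← ((summable_wellPoisedSum₂ hq m).sub (summable_wellPoisedSum₁ hq m)).tsum_sub
      ((summable_wellPoisedSum₁ hq (m + 1)).mul_left _),
    ← tsum_sub_succ_eq_zero hg (by simp)]
  refine tsum_congr fun r => ?_
  have h := wellPoisedTerm_succ_right hq m r
  rw [wellPoisedTerm_succ_left]
  linear_combination q ^ (r + 1) * h

theorem wellPoisedSum₁_recurrence (hq : ‖q‖ < 1) (m : ℕ) :
    wellPoisedSum₁ q m = wellPoisedSum₁ q (m + 1) + q ^ (m + 2) * wellPoisedSum₁ q (m + 2) := by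
  rw [wellPoisedSum₁_eq hq, wellPoisedSum₂_eq hq]

theorem tendsto_wellPoisedSum₁ (hq : ‖q‖ < 1) :
    Tendsto (wellPoisedSum₁ q) atTop (𝓝 (qPochInf q q)) := by
  obtain ⟨M, hM0, hM⟩ := exists_norm_wellPoisedTerm_ratio_le hq
  have hpow := tendsto_pow_atTop_nhds_zero_of_norm_lt_one hq
  have hlim (r : ℕ) : Tendsto (fun m : ℕ => (-1) ^ r * (q ^ (m + 1)) ^ (2 * r) *
      (qPoch q q (m + r) * (qPoch q q r)⁻¹) * (q ^ (2 * r) * (1 - q ^ (m + 1 + 2 * r)))) atTop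
      (𝓝 ((-1) ^ r * 0 ^ (2 * r) * (qPochInf q q * (qPoch q q r)⁻¹) *
        (q ^ (2 * r) * (1 - 0)))) := by
    have h1 := hpow.comp (tendsto_add_atTop_nat 1)
    have h2 := hpow.comp (tendsto_add_atTop_nat (1 + 2 * r))
    have h3 := (tendsto_qPoch q hq).comp (tendsto_add_atTop_nat r)
    simpa only [Function.comp_def, add_assoc] using
      (((h1.pow (2 * r)).const_mul _).mul (h3.mul_const _)).mul ((h2.const_sub 1).const_mul _)
  have hbound (m r : ℕ) : ‖(-1) ^ r * (q ^ (m + 1)) ^ (2 * r) *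
      (qPoch q q (m + r) * (qPoch q q r)⁻¹) * (q ^ (2 * r) * (1 - q ^ (m + 1 + 2 * r)))‖ ≤
      M * (1 * (1 + 1)) := by
    have h1 (k : ℕ) : ‖q ^ k‖ ≤ 1 := by
      rw [norm_pow]
      exact pow_le_one₀ (norm_nonneg q) hq.le
    rw [norm_mul, norm_mul (q ^ (2 * r))]
    gcongr
    · exact hM m r
    · exact h1 _
    · exact (norm_sub_le _ _).trans (add_le_add norm_one.le (h1 _))
  have h := tendsto_tsum_bounded_mul hbound hlim
    (summable_norm_pow_choose (norm_pow_lt_one hq (n := 5) (by norm_num)))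
  rw [tsum_eq_single 0 (fun r hr => by
    rw [zero_pow (mul_ne_zero two_ne_zero hr), mul_zero, zero_mul, zero_mul, zero_mul])] at h
  simp only [pow_zero, mul_zero, qPoch_zero, inv_one, mul_one, one_mul, sub_zero,
    Nat.choose_zero_succ] at h
  refine h.congr fun m => tsum_congr fun r => ?_
  rw [wellPoisedTerm]
  ring

theorem qPochInf_mul_rrSum (hq : ‖q‖ < 1) (m : ℕ) :
    qPochInf q q * rrSum q m = wellPoisedSum₁ q m := by
  refine sub_eq_zero.mp (eq_zero_of_recurrence hq 2
    (d := fun m => qPochInf q q * rrSum q m - wellPoisedSum₁ q m) (fun m => ?_) ?_ m)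
  · linear_combination qPochInf q q * rrSum_recurrence hq m - wellPoisedSum₁_recurrence hq m
  · simpa using ((tendsto_rrSum hq).const_mul (qPochInf q q)).sub (tendsto_wellPoisedSum₁ hq)

theorem wellPoisedSum₁_zero (hq : ‖q‖ < 1) (hq0 : q ≠ 0) :
    wellPoisedSum₁ q 0 =
      qPochInf (q ^ 5) (q ^ 5) * (qPochInf q (q ^ 5) * qPochInf (q ^ 4) (q ^ 5)) := by
  have hq5 : ‖q ^ 5‖ < 1 := norm_pow_lt_one hq (by norm_num)
  have hs (c : ℂ) := (summable_norm_pow_mul_pow_choose c hq5).of_norm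
  rw [jacobi_triple_product hq5 (pow_ne_zero 5 hq0) (by ring)]
  have h4 := hs (-q ^ 4)
  have h1 := hs (-q)
  rw [h1.tsum_eq_zero_add, add_assoc, add_comm (tsum _), ← add_assoc]
  have h0 : (-q) ^ 0 * (q ^ 5) ^ Nat.choose 0 2 = (-q ^ 4) ^ 0 * (q ^ 5) ^ Nat.choose 0 2 := by
    simp
  rw [h0, ← h4.tsum_eq_zero_add, ← h4.tsum_add ((summable_nat_add_iff 1).mpr h1)]
  refine tsum_congr fun r => ?_
  rw [wellPoisedTerm, zero_add, zero_add, mul_inv_cancel₀ (qPoch_self_ne_zero hq r),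
    choose_succ_two, neg_pow (q ^ 4), neg_pow q]
  ring

/-- Splitting `(q; q)_∞` along residue classes modulo `5`. -/
theorem qPochInf_self_eq_prod_mod_five (hq : ‖q‖ < 1) :
    qPochInf q q = qPochInf q (q ^ 5) * qPochInf (q ^ 2) (q ^ 5) * qPochInf (q ^ 3) (q ^ 5) *
      qPochInf (q ^ 4) (q ^ 5) * qPochInf (q ^ 5) (q ^ 5) := by
  have hq5 : ‖q ^ 5‖ < 1 := norm_pow_lt_one hq (by norm_num)
  have hfin (n : ℕ) : qPoch q q (5 * n) = qPoch q (q ^ 5) n * qPoch (q ^ 2) (q ^ 5) n *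
      qPoch (q ^ 3) (q ^ 5) n * qPoch (q ^ 4) (q ^ 5) n * qPoch (q ^ 5) (q ^ 5) n := by
    induction n with
    | zero => simp [qPoch_zero]
    | succ n ih =>
      rw [mul_add, mul_one]
      simp only [qPoch_succ, show 5 * n + 5 = 5 * n + 1 + 1 + 1 + 1 + 1 from rfl, ih]
      ring
  have h5 : Tendsto (fun n : ℕ => 5 * n) atTop atTop :=
    tendsto_id.const_mul_atTop' (by norm_num)
  have ht (a : ℂ) := tendsto_qPoch a hq5
  exact tendsto_nhds_unique (((tendsto_qPoch q hq).comp h5).congr hfin)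
    (((((ht q).mul (ht (q ^ 2))).mul (ht (q ^ 3))).mul (ht (q ^ 4))).mul (ht (q ^ 5)))

theorem qPochInf_pow_succ_ne_zero (hq : ‖q‖ < 1) (a b : ℕ) :
    qPochInf (q ^ (a + 1)) (q ^ (b + 1)) ≠ 0 :=
  qPochInf_ne_zero (norm_pow_lt_one hq b.succ_ne_zero) fun k => by
    rw [← pow_mul, ← pow_add, add_right_comm]
    exact one_sub_pow_succ_ne_zero hq _

/-- The second Rogers–Ramanujan identity. -/
theorem rrSum_zero_mul (hq : ‖q‖ < 1) (hq0 : q ≠ 0) :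
    rrSum q 0 * (qPochInf (q ^ 2) (q ^ 5) * qPochInf (q ^ 3) (q ^ 5)) = 1 := by
  have h := qPochInf_mul_rrSum hq 0
  rw [wellPoisedSum₁_zero hq hq0, qPochInf_self_eq_prod_mod_five hq] at h
  have h1 : qPochInf q (q ^ 5) ≠ 0 := by simpa using qPochInf_pow_succ_ne_zero hq 0 4
  have h4 : qPochInf (q ^ 4) (q ^ 5) ≠ 0 := qPochInf_pow_succ_ne_zero hq 3 4
  have h5 : qPochInf (q ^ 5) (q ^ 5) ≠ 0 := qPochInf_pow_succ_ne_zero hq 4 4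
  refine mul_left_cancel₀ (mul_ne_zero h5 (mul_ne_zero h1 h4)) ?_
  linear_combination h

end RogersRamanujan
section DoubleSums

theorem summable_bounded_mul_pow {x : ℂ} (hx : ‖x‖ < 1) {c : ℕ × ℕ → ℂ} {M : ℝ}
    (hc : ∀ p, ‖c p‖ ≤ M) {E : ℕ × ℕ → ℕ} (hE : ∀ p, p.1 + p.2 ≤ E p) :
    Summable fun p => c p * x ^ E p := by
  have hgeo := summable_geometric_of_lt_one (norm_nonneg x) hx
  have hM : 0 ≤ M := (norm_nonneg _).trans (hc 0)
  refine Summable.of_norm_bounded ((hgeo.mul_of_nonneg hgeo (fun _ => by positivity)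
    fun _ => by positivity).mul_left M) fun p => ?_
  rw [norm_mul, norm_pow, ← pow_add]
  exact mul_le_mul (hc p) (pow_le_pow_of_le_one (norm_nonneg x) hx.le (hE p)) (by positivity) hM

theorem exists_norm_inv_qPoch_mul_le {q : ℂ} (hq : ‖q‖ < 1) :
    ∃ M, ∀ p : ℕ × ℕ, ‖(qPoch q q p.1)⁻¹ * (qPoch q q p.2)⁻¹‖ ≤ M := by
  obtain ⟨B, hB0, hB⟩ := exists_norm_inv_qPoch_le hq
  refine ⟨B * B, fun p => ?_⟩
  rw [norm_mul]
  exact mul_le_mul (hB _) (hB _) (norm_nonneg _) hB0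

theorem qPochInf_eq_qPoch_mul (a : ℂ) {q : ℂ} (hq : ‖q‖ < 1) (n : ℕ) :
    qPochInf a q = qPoch a q n * qPochInf (a * q ^ n) q := by
  have hfin (k : ℕ) : qPoch a q (k + n) = qPoch a q n * qPoch (a * q ^ n) q k := by
    rw [qPoch, add_comm k, prod_range_add]
    simp only [qPoch, pow_add, mul_assoc]
  exact tendsto_nhds_unique
    (((tendsto_qPoch a hq).comp (tendsto_add_atTop_nat n)).congr hfin)
    ((tendsto_qPoch (a * q ^ n) hq).const_mul _)

/-- Rogers's transformation of `∑ x ^ (n ^ 2 + 2 n) / (x⁴; x⁴)_n` to a Rogers–Ramanujan series. -/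
theorem qPochInf_neg_mul_tsum_eq_rrSum {x : ℂ} (hx : ‖x‖ < 1) :
    qPochInf (-(x ^ 2)) (x ^ 2) *
      ∑' n : ℕ, x ^ (n ^ 2 + 2 * n) * (qPoch (x ^ 4) (x ^ 4) n)⁻¹ = rrSum x 0 := by
  have hx2 : ‖x ^ 2‖ < 1 := norm_pow_lt_one hx two_ne_zero
  set e : ℕ → ℂ := fun n => (qPoch (x ^ 2) (x ^ 2) n)⁻¹ with he
  set E : ℕ × ℕ → ℕ := fun p => (p.1 + p.2) ^ 2 + (p.1 + p.2) + p.1 with hE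
  have hexp (n k : ℕ) : x ^ (n ^ 2 + 2 * n) * (((x ^ 2) ^ (n + 1)) ^ k * (x ^ 2) ^ k.choose 2) =
      x ^ E (n, k) := by
    rw [← pow_mul, ← pow_mul, ← pow_mul, ← pow_add, ← pow_add]
    congr 1
    have := two_mul_choose_two_add k
    simp only [hE]
    linarith
  have hsum : Summable fun p : ℕ × ℕ => e p.1 * e p.2 * x ^ E p := by
    obtain ⟨M, hM⟩ := exists_norm_inv_qPoch_mul_le hx2
    exact summable_bounded_mul_pow hx hM fun p => by simp only [hE]; nlinarith
  have hterm (n : ℕ) : qPochInf (-(x ^ 2)) (x ^ 2) *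
      (x ^ (n ^ 2 + 2 * n) * (qPoch (x ^ 4) (x ^ 4) n)⁻¹) =
      ∑' k, e n * e k * x ^ E (n, k) := by
    have hfac : qPoch (-(x ^ 2)) (x ^ 2) n * qPoch (x ^ 2) (x ^ 2) n =
        qPoch (x ^ 4) (x ^ 4) n := by
      rw [qPoch_neg_mul_qPoch, ← pow_mul]
    have hne : qPoch (-(x ^ 2)) (x ^ 2) n ≠ 0 :=
      left_ne_zero_of_mul (hfac ▸ qPoch_self_ne_zero (norm_pow_lt_one hx four_ne_zero) n)
    rw [qPochInf_eq_qPoch_mul _ hx2 n, ← hfac, neg_mul, ← pow_succ', qPochInf_neg_eq_tsum hx2,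
      mul_inv]
    calc _ = (qPoch (-(x ^ 2)) (x ^ 2) n * (qPoch (-(x ^ 2)) (x ^ 2) n)⁻¹) *
          ((e n * x ^ (n ^ 2 + 2 * n)) *
            ∑' k, e k * (((x ^ 2) ^ (n + 1)) ^ k * (x ^ 2) ^ k.choose 2)) := by ring
      _ = _ := by
        rw [mul_inv_cancel₀ hne, one_mul, ← tsum_mul_left]
        refine tsum_congr fun k => ?_
        rw [← hexp]
        ring
  rw [← tsum_mul_left, tsum_congr hterm, ← hsum.tsum_prod, tsum_prod_eq_tsum_sum_antidiagonal hsum,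
    rrSum]
  refine tsum_congr fun n => ?_
  rw [← rogersSzego_sq hx n, sum_mul, sum_mul, ← Nat.sum_antidiagonal_swap]
  refine sum_congr rfl fun p hp => ?_
  have hn : n ^ 2 + n = 2 * n + 2 * n.choose 2 := by
    have := two_mul_choose_two_add n
    linarith
  have hpow : x ^ E p.swap = x ^ p.2 * (x ^ (0 + 2)) ^ n * (x ^ 2) ^ n.choose 2 := by
    rw [← pow_mul, ← pow_mul, ← pow_add, ← pow_add]
    congr 1
    simp only [hE, Prod.fst_swap, Prod.snd_swap]
    rw [add_comm p.2, mem_antidiagonal.mp hp, hn]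
    ring
  rw [hpow]
  simp only [he, Prod.fst_swap, Prod.snd_swap]
  ring

/-- Summing the double series along antidiagonals with Gauss's formula. -/
theorem tsum_double_eq_tsum {q : ℂ} (hq : ‖q‖ < 1) :
    ∑' p : ℕ × ℕ, (-1 : ℂ) ^ p.2 *
        q ^ (p.1 ^ 2 + 2 * p.1 * p.2 + p.2 ^ 2 + 4 * p.1 + 4 * p.2) /
        (qPoch (q ^ 8) (q ^ 8) p.1 * qPoch (q ^ 8) (q ^ 8) p.2) =
      ∑' n : ℕ, (q ^ 4) ^ (n ^ 2 + 2 * n) * (qPoch ((q ^ 4) ^ 4) ((q ^ 4) ^ 4) n)⁻¹ := by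
  have hq8 : ‖q ^ 8‖ < 1 := norm_pow_lt_one hq (by norm_num)
  set f : ℕ × ℕ → ℂ := fun p =>
    (-1) ^ p.2 * ((qPoch (q ^ 8) (q ^ 8) p.1)⁻¹ * (qPoch (q ^ 8) (q ^ 8) p.2)⁻¹) with hf
  have hsum : Summable fun p : ℕ × ℕ => f p * q ^ ((p.1 + p.2) ^ 2 + 4 * (p.1 + p.2)) := by
    obtain ⟨M, hM⟩ := exists_norm_inv_qPoch_mul_le hq8
    refine summable_bounded_mul_pow hq (M := M) (fun p => ?_) fun p => by nlinarith
    rw [hf, norm_mul, norm_pow, norm_neg, norm_one, one_pow, one_mul]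
    exact hM p
  have hanti (n : ℕ) : ∑ p ∈ antidiagonal n, f p * q ^ ((p.1 + p.2) ^ 2 + 4 * (p.1 + p.2)) =
      (∑ p ∈ antidiagonal n, f p) * q ^ (n ^ 2 + 4 * n) := by
    rw [sum_mul]
    exact sum_congr rfl fun p hp => by rw [mem_antidiagonal.mp hp]
  calc _ = ∑' p : ℕ × ℕ, f p * q ^ ((p.1 + p.2) ^ 2 + 4 * (p.1 + p.2)) :=
        tsum_congr fun p => by
          rw [hf, div_eq_mul_inv, mul_inv]
          ring
    _ = ∑' n, (∑ p ∈ antidiagonal n, f p) * q ^ (n ^ 2 + 4 * n) := by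
        rw [tsum_prod_eq_tsum_sum_antidiagonal hsum, tsum_congr hanti]
    _ = ∑' m, (∑ p ∈ antidiagonal (2 * m), f p) * q ^ ((2 * m) ^ 2 + 4 * (2 * m)) := by
        refine ((mul_right_injective₀ two_ne_zero).tsum_eq fun n hn => ?_).symm
        by_contra hodd
        obtain ⟨k, rfl | rfl⟩ := n.even_or_odd'
        · exact hodd ⟨k, rfl⟩
        · have h0 : ∑ p ∈ antidiagonal (2 * k + 1), f p = 0 := (rogersSzego_neg_one hq8 k).2
          exact hn (by simp only [h0, zero_mul])
    _ = _ := tsum_congr fun m => by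
        rw [(rogersSzego_neg_one hq8 m).1, ← pow_mul, ← pow_mul, ← pow_mul, mul_comm]
        congr 2
        ring

end DoubleSums

theorem stmt_7 (q : ℂ) (hq : ‖q‖ < 1) :
    (∑' p : ℕ × ℕ,
        (-1 : ℂ) ^ p.2 *
          q ^ (p.1 ^ 2 + 2 * p.1 * p.2 + p.2 ^ 2 + 4 * p.1 + 4 * p.2) /
          (qPoch (q ^ 8) (q ^ 8) p.1 * qPoch (q ^ 8) (q ^ 8) p.2))
      = 1 / (qPochInf (-(q ^ 8)) (q ^ 8) * qPochInf (q ^ 8) (q ^ 20) *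
          qPochInf (q ^ 12) (q ^ 20)) := by
  rcases eq_or_ne q 0 with rfl | hq0
  · rw [tsum_double_eq_tsum hq, tsum_eq_single 0 fun n hn => by simp [hn]]
    simp [qPochInf, qPoch_zero]
  · have hx : ‖q ^ 4‖ < 1 := norm_pow_lt_one hq four_ne_zero
    have h := rrSum_zero_mul hx (pow_ne_zero 4 hq0)
    rw [← qPochInf_neg_mul_tsum_eq_rrSum hx, ← tsum_double_eq_tsum hq] at h
    simp only [← pow_mul, Nat.reduceMul] at h
    refine eq_one_div_of_mul_eq_one_left ?_
    linear_combination h
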